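/- Let b_{nk} be the number of chains of length k in L_n that contain both ∅ and [n]. Then for every n ≥ 2, the alternating sum ∑_{k=1}^{n} (-1)^k b_{nk} equals μ(n-1), the classical Möbius function evaluated at n-1. (This sum is the reduced Euler characteristic of the order complex of L_n \ {∅, [n]}.) -/

import Mathlib

open scoped Classical

/-- An arithmetic progression of integers: a finite set of the form
`{a, a+r, ..., a+(k-1)r}` with `a : ℤ`, `r ≥ 1` and `k ≥ 0` (so the empty set and all
singletons are arithmetic progressions). -/
def IsAP (s : Finset ℤ) : Prop :=
  ∃ (a r : ℤ) (k : ℕ), 1 ≤ r ∧ s = (Finset.range k).image (fun i => a + (i : ℤ) * r)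

/-- The number `p_{nk}` of arithmetic progressions of cardinality `k` contained in `{1,…,n}`. -/
noncomputable def numAP (n k : ℕ) : ℕ :=
  ((Finset.Icc (1:ℤ) (n:ℤ)).powerset.filter (fun s => IsAP s ∧ s.card = k)).card

/-- The Möbius function of the poset of arithmetic progressions ordered by inclusion,
defined by `μ(x,x) = 1` and `μ(x,y) = -∑_{x ≤ z < y} μ(x,z)`, where `z` ranges over
arithmetic progressions with `x ⊆ z ⊂ y`.  (For `x ⊆ y ⊆ {1,…,n}`, all arithmetic
progressions `z` with `x ⊆ z ⊂ y` automatically lie in `L_n`, so this is the Möbius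
function of any interval `[x, y]` of the lattice `L_n`.) -/
noncomputable def apMu (x y : Finset ℤ) : ℤ :=
  if x = y then 1
  else - ∑ z ∈ (y.powerset.filter (fun z => IsAP z ∧ x ⊆ z ∧ z ≠ y)).attach, apMu x z.1
termination_by y.card
decreasing_by
  rename_i z
  have hz := z.2
  rw [Finset.mem_filter, Finset.mem_powerset] at hz
  exact Finset.card_lt_card (lt_of_le_of_ne hz.1 hz.2.2.2)

/-- The join of `a` and `b` in the lattice of arithmetic progressions contained in `t`:
the intersection of all arithmetic progressions contained in `t` that contain `a ∪ b`,
i.e. the smallest such progression. -/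
noncomputable def apJoin (t a b : Finset ℤ) : Finset ℤ :=
  t.filter (fun v => ∀ z : Finset ℤ, IsAP z → z ⊆ t → a ∪ b ⊆ z → v ∈ z)

/-- The meet (intersection) of a finite family `S` of subsets of the top element `t`;
the meet of the empty family is `t` itself. -/
def apMeet (t : Finset ℤ) (S : Finset (Finset ℤ)) : Finset ℤ :=
  S.fold (· ⊓ ·) t id

/-- `x` is a coatom of the lattice `L_n` of arithmetic progressions contained in
`{1,…,n}`: an element distinct from the maximum `{1,…,n}` with no element strictly
between it and the maximum. -/
def IsCoatomIn (n : ℕ) (x : Finset ℤ) : Prop :=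
  IsAP x ∧ x ⊆ Finset.Icc (1:ℤ) (n:ℤ) ∧ x ≠ Finset.Icc (1:ℤ) (n:ℤ) ∧
    ∀ y : Finset ℤ, IsAP y → y ⊆ Finset.Icc (1:ℤ) (n:ℤ) → x ⊂ y → y = Finset.Icc (1:ℤ) (n:ℤ)

/-- `y` is covered by `top` in the poset of arithmetic progressions: `y < top` and there
is no arithmetic progression strictly between them. -/
def CoveredIn (top y : Finset ℤ) : Prop :=
  IsAP y ∧ y ⊂ top ∧ ¬ ∃ z : Finset ℤ, IsAP z ∧ y ⊂ z ∧ z ⊂ top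

/-- `c` is a maximal chain in the lattice `L_n` of arithmetic progressions contained
in `{1,…,n}`: a chain (under inclusion) of elements of `L_n` to which no further
element of `L_n` can be added. -/
def IsMaxChainIn (n : ℕ) (c : Finset (Finset ℤ)) : Prop :=
  (∀ s ∈ c, IsAP s ∧ s ⊆ Finset.Icc (1:ℤ) (n:ℤ)) ∧
  IsChain (· ⊆ ·) (↑c : Set (Finset ℤ)) ∧
  ∀ z : Finset ℤ, IsAP z → z ⊆ Finset.Icc (1:ℤ) (n:ℤ) →
    IsChain (· ⊆ ·) (insert z (↑c : Set (Finset ℤ))) → z ∈ c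

/-- The number `b_{nk}` of chains of length `k` (i.e. totally ordered subsets with `k+1`
elements) in `L_n` that contain both `∅` and `{1,…,n}`. -/
noncomputable def numChains (n k : ℕ) : ℕ :=
  (((Finset.Icc (1:ℤ) (n:ℤ)).powerset.filter IsAP).powerset.filter
    (fun c : Finset (Finset ℤ) => c.card = k + 1 ∧ ∅ ∈ c ∧ Finset.Icc (1:ℤ) (n:ℤ) ∈ c ∧
      IsChain (· ⊆ ·) (↑c : Set (Finset ℤ)))).card

/-- The chains in `P` that contain `∅` and have maximum `y`. -/
noncomputable def chainsTo (P : Finset (Finset ℤ)) (y : Finset ℤ) : Finset (Finset (Finset ℤ)) :=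
  P.powerset.filter (fun c => IsChain (· ⊆ ·) (↑c : Set (Finset ℤ)) ∧ ∅ ∈ c ∧ y ∈ c ∧
    ∀ w ∈ c, w ⊆ y)

theorem mem_chainsTo {P : Finset (Finset ℤ)} {y : Finset ℤ} {c : Finset (Finset ℤ)} :
    c ∈ chainsTo P y ↔ c ⊆ P ∧ IsChain (· ⊆ ·) (↑c : Set (Finset ℤ)) ∧ ∅ ∈ c ∧ y ∈ c ∧
      ∀ w ∈ c, w ⊆ y := by
  simp [chainsTo]

theorem chainsTo_empty {P : Finset (Finset ℤ)} (h : ∅ ∈ P) : chainsTo P ∅ = {{∅}} := by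
  ext c
  rw [mem_chainsTo, Finset.mem_singleton]
  constructor
  · rintro ⟨-, -, h0, -, h1⟩
    ext w
    rw [Finset.mem_singleton]
    exact ⟨fun hw => Finset.subset_empty.mp (h1 w hw), fun hw => hw ▸ h0⟩
  · rintro rfl
    simp [h]

/-- The signed count of chains from `∅` to `y` satisfies the recursion of the Möbius function. -/
theorem sum_chainsTo {P : Finset (Finset ℤ)} {y : Finset ℤ} (hy : y ∈ P) (hne : y ≠ ∅) :
    ∑ c ∈ chainsTo P y, (-1 : ℤ) ^ c.card
      = - ∑ z ∈ P.filter (· ⊂ y), ∑ c ∈ chainsTo P z, (-1 : ℤ) ^ c.card := by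
  rw [Finset.sum_sigma', ← Finset.sum_neg_distrib]
  symm
  have hnot : ∀ z c, z ⊂ y → c ∈ chainsTo P z → y ∉ c := fun z c hz hc h =>
    hz.not_subset ((mem_chainsTo.mp hc).2.2.2.2 y h)
  refine Finset.sum_bij (fun p _ => insert y p.2) ?_ ?_ ?_ ?_
  · rintro ⟨z, c⟩ hp
    simp only [Finset.mem_sigma, Finset.mem_filter] at hp
    obtain ⟨⟨hz, hzy⟩, hc⟩ := hp
    obtain ⟨h1, h2, h3, h4, h5⟩ := mem_chainsTo.mp hc
    have h6 : ∀ w ∈ c, w ⊆ y := fun w hw => (h5 w hw).trans hzy.subset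
    refine mem_chainsTo.mpr ⟨Finset.insert_subset hy h1, ?_, Finset.mem_insert_of_mem h3,
      Finset.mem_insert_self _ _, ?_⟩
    · rw [Finset.coe_insert]
      exact h2.insert fun b hb _ => Or.inr (h6 b hb)
    · intro w hw
      rcases Finset.mem_insert.mp hw with rfl | hw
      · exact subset_rfl
      · exact h6 w hw
  · rintro ⟨z, c⟩ hp ⟨z', c'⟩ hp' heq
    simp only [Finset.mem_sigma, Finset.mem_filter] at hp hp'
    have hcc : c = c' := by
      have := congrArg (fun s => s.erase y) heq
      simpa [Finset.erase_insert (hnot z c hp.1.2 hp.2),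
        Finset.erase_insert (hnot z' c' hp'.1.2 hp'.2)] using this
    subst hcc
    obtain ⟨-, -, -, h4, h5⟩ := mem_chainsTo.mp hp.2
    obtain ⟨-, -, -, h4', h5'⟩ := mem_chainsTo.mp hp'.2
    rw [(h5' z h4).antisymm (h5 z' h4')]
  · intro c hc
    obtain ⟨h1, h2, h3, h4, h5⟩ := mem_chainsTo.mp hc
    obtain ⟨z, hz⟩ := (c.erase y).exists_maximal ⟨∅, Finset.mem_erase.mpr ⟨hne.symm, h3⟩⟩
    have hzc := Finset.mem_erase.mp hz.1
    refine ⟨⟨z, c.erase y⟩, ?_, Finset.insert_erase h4⟩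
    simp only [Finset.mem_sigma, Finset.mem_filter]
    refine ⟨⟨h1 hzc.2, lt_of_le_of_ne (h5 z hzc.2) hzc.1⟩, mem_chainsTo.mpr
      ⟨(Finset.erase_subset _ _).trans h1, h2.mono (by simp),
        Finset.mem_erase.mpr ⟨hne.symm, h3⟩, hz.1, ?_⟩⟩
    intro w hw
    rcases h2.total (Finset.mem_of_mem_erase hw) hzc.2 with h | h
    · exact h
    · exact hz.2 hw h
  · rintro ⟨z, c⟩ hp
    simp only [Finset.mem_sigma, Finset.mem_filter] at hp
    rw [Finset.card_insert_of_notMem (hnot z c hp.1.2 hp.2), pow_succ]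
    ring

/-- A function that satisfies the recursion of the Möbius function computes the signed count of
chains. -/
theorem sum_chainsTo_eq {P : Finset (Finset ℤ)} (h0 : ∅ ∈ P) {G : Finset ℤ → ℤ} (hG0 : G ∅ = 1)
    (hG : ∀ y ∈ P, y ≠ ∅ → ∑ z ∈ P.filter (· ⊆ y), G z = 0) {y : Finset ℤ} (hy : y ∈ P) :
    ∑ c ∈ chainsTo P y, (-1 : ℤ) ^ c.card = - G y := by
  induction y using Finset.strongInduction with
  | H y ih =>
    by_cases hne : y = ∅
    · subst hne
      simp [chainsTo_empty h0, hG0]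
    · have hsplit : P.filter (· ⊆ y) = insert y (P.filter (· ⊂ y)) := by
        ext z
        simp only [Finset.mem_filter, Finset.mem_insert]
        constructor
        · rintro ⟨hz, hzy⟩
          exact (eq_or_ne z y).imp id fun h => ⟨hz, lt_of_le_of_ne hzy h⟩
        · rintro (rfl | ⟨hz, hzy⟩)
          · exact ⟨hy, subset_rfl⟩
          · exact ⟨hz, hzy.subset⟩
      have hsum := hG y hy hne
      rw [hsplit, Finset.sum_insert (by simp)] at hsum
      rw [sum_chainsTo hy hne, Finset.sum_congr rfl fun z hz =>
        ih z (Finset.mem_filter.mp hz).2 (Finset.mem_filter.mp hz).1, Finset.sum_neg_distrib]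
      linarith

/-- The value of the Möbius function of `L_n` between `∅` and a progression of given
cardinality. -/
def apValue : ℕ → ℤ
  | 0 => 1
  | 1 => -1
  | k + 2 => ArithmeticFunction.moebius (k + 1)

/-- The arithmetic progression with first term `a`, difference `r` and `k` terms. -/
def progression (a r : ℤ) (k : ℕ) : Finset ℤ :=
  (Finset.range k).image (fun i : ℕ => a + (i : ℤ) * r)

theorem mem_progression {a r x : ℤ} {k : ℕ} :
    x ∈ progression a r k ↔ ∃ i < k, a + (i : ℤ) * r = x := by
  simp [progression]

theorem card_progression (a : ℤ) {r : ℤ} (hr : 1 ≤ r) (k : ℕ) : (progression a r k).card = k := by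
  rw [progression, Finset.card_image_of_injective, Finset.card_range]
  intro i j h
  have h' : (i : ℤ) * r = j * r := by simpa using h
  exact_mod_cast mul_right_cancel₀ (by omega) h'

theorem isAP_iff {s : Finset ℤ} :
    IsAP s ↔ ∃ (a r : ℤ) (k : ℕ), 1 ≤ r ∧ s = progression a r k := by
  have h : ∀ (a r : ℤ) (k : ℕ), ((do let i ← Finset.range k; pure (i : ℤ)) : Finset ℤ).image
      (fun i => a + i * r) = progression a r k := by
    intro a r k
    ext x
    simp [mem_progression, Finset.bind_def, Finset.pure_def]
  simp only [← h]
  rfl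

theorem isAP_progression (a : ℤ) {r : ℤ} (hr : 1 ≤ r) (k : ℕ) : IsAP (progression a r k) :=
  isAP_iff.mpr ⟨a, r, k, hr, rfl⟩

theorem le_of_mem_progression {a r x : ℤ} (hr : 1 ≤ r) {k : ℕ} (hx : x ∈ progression a r k) : a ≤ x := by
  obtain ⟨i, -, rfl⟩ := mem_progression.mp hx
  have : 0 ≤ (i : ℤ) * r := by positivity
  omega

theorem le_last_of_mem_progression {a r x : ℤ} (hr : 1 ≤ r) {k : ℕ} (hx : x ∈ progression a r (k + 1)) :
    x ≤ a + k * r := by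
  obtain ⟨i, hi, rfl⟩ := mem_progression.mp hx
  have : (i : ℤ) ≤ k := by omega
  nlinarith

theorem progression_injective {a a' r r' : ℤ} {k k' : ℕ} (hr : 1 ≤ r) (hr' : 1 ≤ r')
    (hk : 1 ≤ k) (h : progression a r (k + 1) = progression a' r' (k' + 1)) :
    a = a' ∧ r = r' ∧ k = k' := by
  have hkk : k = k' := by
    have := congrArg Finset.card h
    rw [card_progression _ hr, card_progression _ hr'] at this
    omega
  subst hkk
  have haa : a = a' := by
    apply le_antisymm
    · exact le_of_mem_progression hr (h.symm ▸ mem_progression.mpr ⟨0, by omega, by simp⟩ :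
        a' ∈ progression a r (k + 1))
    · exact le_of_mem_progression hr' (h ▸ mem_progression.mpr ⟨0, by omega, by simp⟩ :
        a ∈ progression a' r' (k + 1))
  subst haa
  have h1 : a + k * r ≤ a + k * r' :=
    le_last_of_mem_progression hr' (h ▸ mem_progression.mpr ⟨k, by omega, rfl⟩)
  have h2 : a + k * r' ≤ a + k * r :=
    le_last_of_mem_progression hr (h ▸ mem_progression.mpr ⟨k, by omega, rfl⟩)
  have hk0 : (k : ℤ) ≠ 0 := by omega
  exact ⟨rfl, mul_left_cancel₀ hk0 (by omega), rfl⟩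

theorem sum_moebius_divisorsAntidiagonal (e : ℕ) :
    ∑ q ∈ e.divisorsAntidiagonal, ArithmeticFunction.moebius q.1 = if e = 1 then 1 else 0 := by
  rw [Nat.sum_divisorsAntidiagonal (fun i _ => ArithmeticFunction.moebius i),
    ← ArithmeticFunction.coe_mul_zeta_apply, ArithmeticFunction.moebius_mul_coe_zeta,
    ArithmeticFunction.one_apply]

/-- Summing over progressions with at least two terms, grouped by their extremities. -/
theorem sum_apValue_two_le_card (a : ℤ) {r : ℤ} (hr : 1 ≤ r) (m : ℕ) :
    ∑ z ∈ (progression a r (m + 1)).powerset.filter (fun z => IsAP z ∧ 2 ≤ z.card),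
      apValue z.card = m := by
  have key : ∑ p ∈ (Finset.range (m + 1) ×ˢ Finset.Icc 1 m).filter (fun p => p.1 + p.2 ≤ m),
      ∑ q ∈ p.2.divisorsAntidiagonal, ArithmeticFunction.moebius q.1 = (m : ℤ) := by
    simp_rw [sum_moebius_divisorsAntidiagonal]
    rw [← Finset.sum_filter, Finset.sum_const, nsmul_one]
    have : ((Finset.range (m + 1) ×ˢ Finset.Icc 1 m).filter (fun p => p.1 + p.2 ≤ m)).filter
        (fun p => p.2 = 1) = (Finset.range m).image (fun i => (i, 1)) := by
      ext ⟨i, e⟩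
      simp only [Finset.mem_filter, Finset.mem_product, Finset.mem_range, Finset.mem_Icc,
        Finset.mem_image, Prod.mk.injEq]
      constructor
      · rintro ⟨⟨-, h⟩, rfl⟩
        exact ⟨i, by omega, rfl, rfl⟩
      · rintro ⟨j, hj, rfl, rfl⟩
        omega
    rw [this, Finset.card_image_of_injective _ (fun i j h => (Prod.mk.inj h).1), Finset.card_range]
  rw [← key, Finset.sum_sigma']
  symm
  have hpos : ∀ {d : ℕ}, 1 ≤ d → 1 ≤ (d : ℤ) * r := fun {d} hd => by
    have : (1 : ℤ) ≤ d := by exact_mod_cast hd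
    nlinarith
  have hmem : ∀ p : (_ : ℕ × ℕ) × (ℕ × ℕ),
      p ∈ ((Finset.range (m + 1) ×ˢ Finset.Icc 1 m).filter (fun p => p.1 + p.2 ≤ m)).sigma
        (fun p => p.2.divisorsAntidiagonal) ↔
      1 ≤ p.2.1 ∧ 1 ≤ p.2.2 ∧ p.2.1 * p.2.2 = p.1.2 ∧ p.1.1 + p.2.1 * p.2.2 ≤ m := by
    rintro ⟨⟨i, e⟩, k, d⟩
    simp only [Finset.mem_sigma, Finset.mem_filter, Finset.mem_product, Finset.mem_range,
      Finset.mem_Icc, Nat.mem_divisorsAntidiagonal]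
    constructor
    · rintro ⟨⟨-, h⟩, rfl, h0⟩
      exact ⟨Nat.pos_of_ne_zero (left_ne_zero_of_mul h0),
        Nat.pos_of_ne_zero (right_ne_zero_of_mul h0), rfl, h⟩
    · rintro ⟨hk, hd, rfl, h⟩
      have : 1 ≤ k * d := Nat.mul_pos hk hd
      omega
  refine Finset.sum_bij (fun p _ => progression (a + p.1.1 * r) (p.2.2 * r) (p.2.1 + 1)) ?_ ?_ ?_ ?_
  · rintro ⟨⟨i, e⟩, k, d⟩ hp
    obtain ⟨hk, hd, he, h⟩ := (hmem _).mp hp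
    dsimp only at hk hd he h ⊢
    rw [Finset.mem_filter, Finset.mem_powerset, card_progression _ (hpos hd)]
    refine ⟨?_, isAP_progression _ (hpos hd) _, by omega⟩
    intro x hx
    obtain ⟨t, ht, rfl⟩ := mem_progression.mp hx
    have : t * d ≤ k * d := Nat.mul_le_mul_right _ (by omega)
    exact mem_progression.mpr ⟨i + t * d, by omega, by push_cast; ring⟩
  · rintro ⟨⟨i, e⟩, k, d⟩ hp ⟨⟨i', e'⟩, k', d'⟩ hp' heq
    obtain ⟨hk, hd, he, h⟩ := (hmem _).mp hp
    obtain ⟨hk', hd', he', h'⟩ := (hmem _).mp hp'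
    dsimp only at hk hd he h hk' hd' he' h' heq
    obtain ⟨h1, h2, rfl⟩ := progression_injective (hpos hd) (hpos hd') hk heq
    have hr0 : r ≠ 0 := by omega
    have hi : i = i' := by exact_mod_cast mul_right_cancel₀ hr0 (add_left_cancel h1)
    have hdd : d = d' := by exact_mod_cast mul_right_cancel₀ hr0 h2
    subst hi hdd he he'
    rfl
  · intro z hz
    rw [Finset.mem_filter, Finset.mem_powerset] at hz
    obtain ⟨hsub, hap, hcard⟩ := hz
    obtain ⟨b, s, l, hs, rfl⟩ := isAP_iff.mp hap
    rw [card_progression _ hs] at hcard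
    obtain ⟨k, rfl⟩ : ∃ k, l = k + 1 := ⟨l - 1, by omega⟩
    obtain ⟨i, hi, hib⟩ := mem_progression.mp
      (hsub (mem_progression.mpr ⟨0, by omega, rfl⟩))
    obtain ⟨j, hj, hjb⟩ := mem_progression.mp
      (hsub (mem_progression.mpr ⟨1, by omega, rfl⟩))
    obtain ⟨t, ht, htb⟩ := mem_progression.mp
      (hsub (mem_progression.mpr ⟨k, by omega, rfl⟩))
    push_cast at hib hjb
    have hij : i < j := by
      by_contra! hle
      have : (j : ℤ) ≤ i := by exact_mod_cast hle
      nlinarith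
    obtain ⟨d, rfl⟩ := Nat.exists_eq_add_of_lt hij
    have hsd : s = ((d + 1 : ℕ) : ℤ) * r := by
      push_cast at hjb ⊢
      linarith
    have hb : b = a + i * r := by linarith
    have htk : i + k * (d + 1) = t := by
      have : ((i + k * (d + 1) : ℕ) : ℤ) * r = t * r := by
        rw [hsd, hb] at htb
        push_cast at htb ⊢
        linarith
      exact_mod_cast mul_right_cancel₀ (by omega) this
    refine ⟨⟨(i, k * (d + 1)), (k, d + 1)⟩, (hmem _).mpr ⟨?_, ?_, rfl, ?_⟩, ?_⟩
    · dsimp only; omega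
    · dsimp only; omega
    · dsimp only; omega
    · dsimp only
      rw [hsd, hb]
  · rintro ⟨⟨i, e⟩, k, d⟩ hp
    obtain ⟨hk, hd, -, -⟩ := (hmem _).mp hp
    dsimp only at hk hd ⊢
    rw [card_progression _ (hpos hd)]
    obtain ⟨k, rfl⟩ : ∃ l, k = l + 1 := ⟨k - 1, by omega⟩
    rfl

theorem isAP_empty : IsAP ∅ := ⟨0, 1, 0, le_rfl, by simp⟩

theorem isAP_singleton (x : ℤ) : IsAP {x} := ⟨x, 1, 1, le_rfl, by simp⟩

theorem sum_apValue_card_lt_two (y : Finset ℤ) :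
    ∑ z ∈ y.powerset.filter (fun z => IsAP z ∧ ¬ 2 ≤ z.card), apValue z.card = 1 - y.card := by
  have h : y.powerset.filter (fun z => IsAP z ∧ ¬ 2 ≤ z.card)
      = insert ∅ (y.image fun x => {x}) := by
    ext z
    simp only [Finset.mem_filter, Finset.mem_powerset, Finset.mem_insert, Finset.mem_image]
    constructor
    · rintro ⟨hz, -, hc⟩
      rcases Finset.card_le_one_iff_subset_singleton.mp (by omega : z.card ≤ 1) with ⟨x, hx⟩
      rcases Finset.subset_singleton_iff.mp hx with rfl | rfl
      · exact Or.inl rfl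
      · exact Or.inr ⟨x, by simpa using hz, rfl⟩
    · rintro (rfl | ⟨x, hx, rfl⟩)
      · simp [isAP_empty]
      · simp [isAP_singleton, hx]
  rw [h, Finset.sum_insert (by simp), Finset.sum_image (by simp)]
  simp [apValue, sub_eq_add_neg]

theorem sum_apValue {y : Finset ℤ} (hy : IsAP y) (hne : y ≠ ∅) :
    ∑ z ∈ y.powerset.filter IsAP, apValue z.card = 0 := by
  obtain ⟨a, r, k, hr, rfl⟩ := isAP_iff.mp hy
  obtain ⟨m, rfl⟩ : ∃ m, k = m + 1 := Nat.exists_eq_succ_of_ne_zero (by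
    rintro rfl
    exact hne (by simp [progression]))
  rw [← Finset.sum_filter_add_sum_filter_not _ (fun z => 2 ≤ z.card), Finset.filter_filter,
    Finset.filter_filter, sum_apValue_two_le_card a hr, sum_apValue_card_lt_two,
    card_progression a hr]
  push_cast
  ring

theorem isAP_Icc (n : ℕ) : IsAP (Finset.Icc (1 : ℤ) n) := by
  refine isAP_iff.mpr ⟨1, 1, n, le_rfl, ?_⟩
  ext x
  simp only [Finset.mem_Icc, mem_progression, mul_one]
  constructor
  · rintro ⟨h1, h2⟩
    exact ⟨(x - 1).toNat, by omega, by omega⟩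
  · rintro ⟨i, hi, rfl⟩
    omega

theorem card_le_of_isChain {y : Finset ℤ} {c : Finset (Finset ℤ)}
    (hc : IsChain (· ⊆ ·) (↑c : Set (Finset ℤ))) (h : ∀ w ∈ c, w ⊆ y) :
    c.card ≤ y.card + 1 := by
  rw [← Finset.card_range (y.card + 1)]
  refine Finset.card_le_card_of_injOn Finset.card ?_ ?_
  · intro w hw
    simpa [Nat.lt_succ_iff] using Finset.card_le_card (h w hw)
  · intro w hw w' hw' heq
    rcases hc.total hw hw' with h | h
    · exact Finset.eq_of_subset_of_card_le h heq.ge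
    · exact (Finset.eq_of_subset_of_card_le h heq.le).symm

theorem sum_numChains (n : ℕ) (hn : 1 ≤ n) :
    ∑ k ∈ Finset.Icc 1 n, (-1 : ℤ) ^ k * (numChains n k : ℤ)
      = - ∑ c ∈ chainsTo ((Finset.Icc (1 : ℤ) n).powerset.filter IsAP) (Finset.Icc (1 : ℤ) n),
          (-1 : ℤ) ^ c.card := by
  have hne : (∅ : Finset ℤ) ≠ Finset.Icc (1 : ℤ) n := by
    rw [ne_comm, ← Finset.nonempty_iff_ne_empty, Finset.nonempty_Icc]
    exact_mod_cast hn
  have hmaps : ∀ c ∈ chainsTo ((Finset.Icc (1 : ℤ) n).powerset.filter IsAP)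
      (Finset.Icc (1 : ℤ) n), c.card ∈ (Finset.Icc 1 n).image (· + 1) := by
    intro c hc
    obtain ⟨h1, h2, h3, h4, h5⟩ := mem_chainsTo.mp hc
    have hlt : 1 < c.card := Finset.one_lt_card.mpr ⟨_, h3, _, h4, hne⟩
    have hle := card_le_of_isChain h2 h5
    rw [Int.card_Icc] at hle
    exact Finset.mem_image.mpr ⟨c.card - 1, by rw [Finset.mem_Icc]; omega, by omega⟩
  rw [← Finset.sum_fiberwise_of_maps_to hmaps, Finset.sum_image (by simp),
    ← Finset.sum_neg_distrib]
  refine Finset.sum_congr rfl fun k _ => ?_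
  rw [Finset.sum_congr rfl fun c hc => by rw [(Finset.mem_filter.mp hc).2], Finset.sum_const,
    nsmul_eq_mul, pow_succ]
  have : numChains n k = ((chainsTo ((Finset.Icc (1 : ℤ) n).powerset.filter IsAP)
      (Finset.Icc (1 : ℤ) n)).filter fun c => c.card = k + 1).card := by
    rw [numChains]
    congr 1
    ext c
    simp only [Finset.mem_filter, mem_chainsTo, Finset.mem_powerset]
    constructor
    · rintro ⟨h1, h2, h3, h4, h5⟩
      exact ⟨⟨h1, h5, h3, h4, fun w hw =>
        Finset.mem_powerset.mp (Finset.mem_filter.mp (h1 hw)).1⟩, h2⟩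
    · rintro ⟨⟨h1, h5, h3, h4, -⟩, h2⟩
      exact ⟨h1, h2, h3, h4, h5⟩
  rw [this]
  ring

/-- For `n ≥ 2`, the alternating sum `∑_{k=1}^{n} (-1)^k b_{nk}` (the reduced Euler
characteristic of the order complex of `L_n \ {∅, [n]}`) equals the classical Möbius
function at `n-1`. -/
theorem alternating_sum_numChains (n : ℕ) (hn : 2 ≤ n) :
    ∑ k ∈ Finset.Icc 1 n, (-1:ℤ)^k * (numChains n k : ℤ)
      = ArithmeticFunction.moebius (n - 1) := by
  rw [sum_numChains n (by omega), sum_chainsTo_eq (G := fun z => apValue z.card)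
    (by simp [isAP_empty]) rfl ?_ (by simp [isAP_Icc]), neg_neg, Int.card_Icc]
  · obtain ⟨k, rfl⟩ := Nat.exists_eq_add_of_le' hn
    rw [show ((((k + 2 : ℕ) : ℤ) + 1 - 1).toNat) = k + 2 by omega]
    rfl
  · intro y hy hne
    rw [Finset.mem_filter, Finset.mem_powerset] at hy
    rw [← sum_apValue hy.2 hne]
    refine Finset.sum_congr ?_ fun _ _ => rfl
    ext z
    simp only [Finset.mem_filter, Finset.mem_powerset]
    exact ⟨fun h => ⟨h.2, h.1.2⟩, fun h => ⟨⟨h.1.trans hy.1, h.2⟩, h.1⟩⟩
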